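/- arXiv:2501.02382 — 3 statements merged into one kernel-verified Lean document; each statement's English description precedes it below -/
import Mathlib

section
/- Let α be a simple root, w̃₂ ∈ W̃₁ and w̃₁ ∈ W̃⁺ with w̃₁ ↑ w̃_h⁻¹w̃₂. Then s_α w₀ w̃₁ ≤ w₀ w̃_h⁻¹ w̃₂ in the Bruhat order on W̃. -/
open scoped Classical Pointwise

namespace SerrePaper

variable (V : Type) [AddCommGroup V] [Module ℝ V]

/-- The combinatorial context of the paper: the character lattice `X` of a split maximal
torus, sitting inside the real vector space `V = X ⊗ ℝ`, together with a reduced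
crystallographic root system `R` with positive roots `Rpos`, simple roots `Δ`,
the coroot pairing `coroot α = ⟨·, α∨⟩`, the weight `η` pairing to `1` with every simple
coroot, and the longest element `w0` of the Weyl group. -/
structure Ctx where
  R : Finset V
  Rpos : Finset V
  Δ : Finset V
  coroot : V → V →ₗ[ℝ] ℝ
  eta : V
  w0 : V ≃ₗ[ℝ] V
  X : AddSubgroup V
  pos_subset : Rpos ⊆ R
  simple_subset : Δ ⊆ Rpos
  root_ne_zero : ∀ α ∈ R, α ≠ (0 : V)
  neg_mem : ∀ α ∈ R, -α ∈ R
  pos_or_neg : ∀ α ∈ R, α ∈ Rpos ∨ -α ∈ Rpos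
  pos_not_neg : ∀ α ∈ Rpos, -α ∉ Rpos
  coroot_self : ∀ α ∈ R, coroot α α = 2
  coroot_neg : ∀ α ∈ R, coroot (-α) = -coroot α
  crystallographic : ∀ α ∈ R, ∀ β ∈ R, ∃ n : ℤ, coroot α β = (n : ℝ)
  reduced : ∀ α ∈ R, ∀ c : ℝ, c • α ∈ R → c = 1 ∨ c = -1
  reflect_root : ∀ α ∈ R, ∀ β ∈ R, β - coroot α β • α ∈ R
  reflect_coroot : ∀ α ∈ R, ∀ β ∈ R, ∀ x : V,
    coroot (β - coroot α β • α) x = coroot β x - coroot β α * coroot α x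
  pos_sum_simple : ∀ α ∈ Rpos, ∃ c : V → ℕ, α = ∑ β ∈ Δ, (c β : ℝ) • β
  simple_indep : LinearIndependent ℝ (fun β : {x // x ∈ Δ} => (β : V))
  eta_pair : ∀ α ∈ Δ, coroot α eta = 1
  root_mem_X : ∀ α ∈ R, α ∈ X
  eta_mem_X : eta ∈ X
  coroot_int : ∀ α ∈ R, ∀ x ∈ X, ∃ n : ℤ, coroot α x = (n : ℝ)
  w0_mem : w0 ∈ Subgroup.closure {g : V ≃ₗ[ℝ] V | ∃ α ∈ R, ∀ x, g x = x - coroot α x • α}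
  w0_neg : ∀ α ∈ Rpos, -(w0 α) ∈ Rpos

namespace Ctx

variable {V}
variable (S : Ctx V)

/-- The (finite) Weyl group, generated by the reflections `s_α`, `α ∈ R`. -/
def Weyl : Subgroup (V ≃ₗ[ℝ] V) :=
  Subgroup.closure {g : V ≃ₗ[ℝ] V | ∃ α ∈ S.R, ∀ x, g x = x - S.coroot α x • α}

/-- The translation `t_ν` as an affine automorphism of `V`. -/
def trans (_S : Ctx V) (ν : V) : V ≃ᵃ[ℝ] V := AffineEquiv.constVAdd ℝ V ν

/-- A linear automorphism viewed as an affine automorphism. -/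
def ofW (_S : Ctx V) (w : V ≃ₗ[ℝ] V) : V ≃ᵃ[ℝ] V := w.toAffineEquiv

/-- The extended affine Weyl group `W̃ = X ⋊ W`, realized as the set of affine
transformations of the form `t_ν ∘ w` with `ν ∈ X` and `w ∈ W`. -/
def extAff : Set (V ≃ᵃ[ℝ] V) :=
  {g | ∃ ν ∈ S.X, ∃ w ∈ S.Weyl, g = S.trans ν * S.ofW w}

/-- The base alcove `A₀`. -/
def A0 : Set V := {x | ∀ α ∈ S.Rpos, 0 < S.coroot α x ∧ S.coroot α x < 1}

/-- The affine hyperplane `⟨·,α∨⟩ = n` separates the base alcove `A₀` from its image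
`g(A₀)`. -/
def Separates (α : V) (n : ℤ) (g : V ≃ᵃ[ℝ] V) : Prop :=
  ((∀ x ∈ S.A0, S.coroot α x < (n : ℝ)) ∧ (∀ x ∈ S.A0, (n : ℝ) < S.coroot α (g x))) ∨
  ((∀ x ∈ S.A0, (n : ℝ) < S.coroot α x) ∧ (∀ x ∈ S.A0, S.coroot α (g x) < (n : ℝ)))

/-- The length `ℓ(g)` of an element of the extended affine Weyl group: the number of
affine root hyperplanes separating `A₀` from `g(A₀)`. -/
noncomputable def len (g : V ≃ᵃ[ℝ] V) : ℕ :=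
  Set.ncard {q : V × ℤ | q.1 ∈ S.Rpos ∧ S.Separates q.1 q.2 g}

/-- The set of affine reflections `s_{α,n} : x ↦ x - (⟨x,α∨⟩ - n)α`. -/
def affRefl : Set (V ≃ᵃ[ℝ] V) :=
  {g | ∃ α ∈ S.R, ∃ n : ℤ, ∀ x, g x = x - (S.coroot α x - (n : ℝ)) • α}

/-- The Bruhat order on the extended affine Weyl group, generated by
`u < r·u` for affine reflections `r` with `ℓ(u) < ℓ(r·u)` (this fixes the
`Ω`-component, so it is the componentwise extension of the Bruhat order on `W_a`). -/
def bruhatLE : (V ≃ᵃ[ℝ] V) → (V ≃ᵃ[ℝ] V) → Prop :=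
  Relation.ReflTransGen fun u w => (∃ r ∈ S.affRefl, w = r * u) ∧ S.len u < S.len w

/-- Jantzen's `↑`-order, transported to the (extended) affine Weyl group via
`w̃ ↦ w̃(A₀)`: generated by `u ↑ s_{α,n}·u` whenever `u(A₀)` lies below the hyperplane
`⟨·,α∨⟩ = n`.  (Under the affine rescaling `λ ↦ (λ+η)/p` this is equivalent to the usual
`↑`-order on `p`-alcoves, transported via the `p`-dot action `w̃ ↦ w̃ · C₀`.) -/
def upLE : (V ≃ᵃ[ℝ] V) → (V ≃ᵃ[ℝ] V) → Prop :=
  Relation.ReflTransGen fun u w =>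
    ∃ α ∈ S.Rpos, ∃ n : ℤ,
      (∀ x : V, w x = u x - (S.coroot α (u x) - (n : ℝ)) • α) ∧
      ∀ x ∈ S.A0, S.coroot α (u x) < (n : ℝ)

/-- `W̃⁺`: the elements of `W̃` taking the base alcove to a dominant alcove. -/
def Wplus : Set (V ≃ᵃ[ℝ] V) :=
  {g | g ∈ S.extAff ∧ ∀ x ∈ S.A0, ∀ α ∈ S.Δ, 0 < S.coroot α (g x)}

/-- `W̃₁`: the elements of `W̃` taking the base alcove to a restricted alcove. -/
def Wone : Set (V ≃ᵃ[ℝ] V) :=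
  {g | g ∈ S.extAff ∧ ∀ x ∈ S.A0, ∀ α ∈ S.Δ,
    0 < S.coroot α (g x) ∧ S.coroot α (g x) < 1}

/-- `w̃_h = w₀ t_{-η}`. -/
noncomputable def wh : V ≃ᵃ[ℝ] V := S.ofW S.w0 * S.trans (-S.eta)

/-- The lowest `p`-alcove `C₀`. -/
def C0 (p : ℕ) : Set V :=
  {x | ∀ α ∈ S.Rpos, 0 < S.coroot α (x + S.eta) ∧ S.coroot α (x + S.eta) < (p : ℝ)}

/-- The root lattice `ℤR`. -/
def rootLattice : AddSubgroup V := AddSubgroup.closure (S.R : Set V)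

/-- `Ω`: the stabilizer of the base alcove in `W̃`. -/
def Omega : Set (V ≃ᵃ[ℝ] V) := {g | g ∈ S.extAff ∧ g '' S.A0 = S.A0}

/-- The `λ`-admissible set `Adm(λ) = ⋃_{w ∈ W} W̃_{≤ t_{w(λ)}}`. -/
def Adm (lam : V) : Set (V ≃ᵃ[ℝ] V) :=
  {g | ∃ w ∈ S.Weyl, S.bruhatLE g (S.trans (w lam))}

/-- `α∨` is a highest coroot, i.e. the highest root of an irreducible component of the
dual root system `R∨`: equivalently, `α∨` is a dominant coroot and no simple coroot can
be added to `α∨` to yield a coroot. -/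
def IsHighestCoroot (α : V) : Prop :=
  α ∈ S.R ∧ (∀ β ∈ S.Δ, 0 ≤ S.coroot α β) ∧
    ∀ β ∈ S.Δ, ∀ γ ∈ S.R, S.coroot γ ≠ S.coroot α + S.coroot β

end Ctx

namespace Ctx

variable {V}
variable (S : Ctx V)

/-- The invariant bilinear form `∑ γ, ⟨x, γ∨⟩⟨y, γ∨⟩`. -/
noncomputable def form (x y : V) : ℝ := ∑ γ ∈ S.R, S.coroot γ x * S.coroot γ y

lemma reflect_reflect {β γ : V} (hβ : β ∈ S.R) :
    (γ - S.coroot β γ • β) - S.coroot β (γ - S.coroot β γ • β) • β = γ := by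
  simp only [map_sub, map_smul, S.coroot_self β hβ, smul_eq_mul]
  module

lemma form_reflect {β : V} (hβ : β ∈ S.R) (x y : V) :
    S.form (x - S.coroot β x • β) (y - S.coroot β y • β) = S.form x y := by
  unfold form
  refine Finset.sum_nbij' (fun γ => γ - S.coroot β γ • β) (fun γ => γ - S.coroot β γ • β)
    (fun γ hγ => S.reflect_root β hβ γ hγ) (fun γ hγ => S.reflect_root β hβ γ hγ)
    (fun γ _ => S.reflect_reflect hβ) (fun γ _ => S.reflect_reflect hβ) ?_
  intro γ hγ
  rw [S.reflect_coroot β hβ γ hγ, S.reflect_coroot β hβ γ hγ]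
  simp only [map_sub, map_smul, smul_eq_mul]
  ring

lemma two_mul_form {β : V} (hβ : β ∈ S.R) (x : V) :
    2 * S.form x β = S.coroot β x * S.form β β := by
  have h := S.form_reflect hβ x β
  simp only [form, map_sub, map_smul, smul_eq_mul, S.coroot_self β hβ] at h ⊢
  have e : ∑ γ ∈ S.R, (S.coroot γ x - S.coroot β x * S.coroot γ β) *
      (S.coroot γ β - 2 * S.coroot γ β) =
      - ∑ γ ∈ S.R, S.coroot γ x * S.coroot γ β +
      S.coroot β x * ∑ γ ∈ S.R, S.coroot γ β * S.coroot γ β := by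
    rw [Finset.mul_sum, ← Finset.sum_neg_distrib, ← Finset.sum_add_distrib]
    exact Finset.sum_congr rfl fun γ _ => by ring
  linarith

lemma form_self_pos {β : V} (hβ : β ∈ S.R) : 0 < S.form β β :=
  Finset.sum_pos' (fun γ _ => mul_self_nonneg _)
    ⟨β, hβ, by rw [S.coroot_self β hβ]; norm_num⟩

lemma form_sum (x : V) (s : Finset V) (c : V → ℝ) :
    S.form x (∑ β ∈ s, c β • β) = ∑ β ∈ s, c β * S.form x β := by
  unfold form
  simp only [map_sum, map_smul, smul_eq_mul, Finset.mul_sum]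
  rw [Finset.sum_comm]
  exact Finset.sum_congr rfl fun _ _ => Finset.sum_congr rfl fun _ _ => by ring

lemma coroot_pos_of_simple {x : V} (hx : ∀ α ∈ S.Δ, 0 < S.coroot α x) {β : V}
    (hβ : β ∈ S.Rpos) : 0 < S.coroot β x := by
  have hβR := S.pos_subset hβ
  have hpos : ∀ γ ∈ S.Δ, 0 < S.form x γ := fun γ hγ => by
    have hγR := S.pos_subset (S.simple_subset hγ)
    have := S.two_mul_form hγR x
    have := mul_pos (hx γ hγ) (S.form_self_pos hγR)
    linarith
  obtain ⟨c, hc⟩ := S.pos_sum_simple β hβ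
  have hform : 0 < S.form x β := by
    rw [hc, form_sum]
    have hex : ∃ γ ∈ S.Δ, c γ ≠ 0 := by
      by_contra! h
      refine S.root_ne_zero β hβR (hc.trans (Finset.sum_eq_zero fun γ hγ => ?_))
      simp [h γ hγ]
    obtain ⟨γ, hγ, hcγ⟩ := hex
    exact Finset.sum_pos' (fun δ hδ => mul_nonneg (Nat.cast_nonneg _) (hpos δ hδ).le)
      ⟨γ, hγ, mul_pos (by exact_mod_cast Nat.pos_of_ne_zero hcγ) (hpos γ hγ)⟩
  have h := S.two_mul_form hβR x
  exact pos_of_mul_pos_left (by linarith) (S.form_self_pos hβR).le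

lemma coroot_eta_pos {β : V} (hβ : β ∈ S.Rpos) : 0 < S.coroot β S.eta :=
  S.coroot_pos_of_simple (fun α hα => by rw [S.eta_pair α hα]; exact one_pos) hβ

lemma weyl_root {w : V ≃ₗ[ℝ] V} (hw : w ∈ S.Weyl) :
    ∀ β ∈ S.R, w β ∈ S.R ∧ ∀ x, S.coroot (w β) (w x) = S.coroot β x := by
  unfold Weyl at hw
  induction hw using Subgroup.closure_induction with
  | mem g hg =>
    obtain ⟨α, hα, hg⟩ := hg
    intro β hβ
    refine ⟨hg β ▸ S.reflect_root α hα β hβ, fun x => ?_⟩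
    rw [hg β, hg x, S.reflect_coroot α hα β hβ]
    simp only [map_sub, map_smul, smul_eq_mul, S.coroot_self α hα]
    ring
  | one => exact fun β hβ => ⟨hβ, fun x => rfl⟩
  | mul g h _ _ hg hh =>
    intro β hβ
    obtain ⟨h1, h2⟩ := hh β hβ
    exact ⟨(hg _ h1).1, fun x => ((hg _ h1).2 _).trans (h2 x)⟩
  | inv g _ hg =>
    intro β hβ
    obtain ⟨δ, hδ, rfl⟩ := Finset.surjOn_of_injOn_of_card_le (s := S.R) (t := S.R) g
      (fun γ hγ => (hg γ hγ).1) g.injective.injOn le_rfl hβ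
    have e : ∀ y, g⁻¹ (g y) = y := fun y => g.symm_apply_apply y
    refine ⟨by rwa [e], fun x => ?_⟩
    rw [e, ← (hg δ hδ).2]
    exact congrArg _ (g.apply_symm_apply x)

/-- `g` permutes the affine root hyperplanes. -/
def PreservesHyperplanes (g : V ≃ᵃ[ℝ] V) : Prop :=
  ∀ β ∈ S.R, ∃ γ ∈ S.R, ∃ m : ℤ, ∀ v, S.coroot β (g v) = S.coroot γ v + m

variable {S}

lemma preservesHyperplanes_of_mem_extAff {g : V ≃ᵃ[ℝ] V} (hg : g ∈ S.extAff) :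
    S.PreservesHyperplanes g := by
  obtain ⟨ν, hν, w, hw, rfl⟩ := hg
  intro β hβ
  obtain ⟨m, hm⟩ := S.coroot_int β hβ ν hν
  obtain ⟨h1, h2⟩ := S.weyl_root (inv_mem hw) β hβ
  refine ⟨w⁻¹ β, h1, m, fun v => ?_⟩
  have e : w⁻¹ (w v) = v := w.symm_apply_apply v
  have : (S.trans ν * S.ofW w) v = ν + w v := rfl
  rw [this, map_add, hm, ← h2 (w v), e, add_comm]

lemma PreservesHyperplanes.reflect {u w : V ≃ᵃ[ℝ] V} (hu : S.PreservesHyperplanes u)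
    {α : V} (hα : α ∈ S.R) {n : ℤ}
    (hw : ∀ x, w x = u x - (S.coroot α (u x) - (n : ℝ)) • α) :
    S.PreservesHyperplanes w := by
  intro β hβ
  obtain ⟨γ, hγ, m, h⟩ := hu _ (S.reflect_root α hα β hβ)
  obtain ⟨k, hk⟩ := S.crystallographic β hβ α hα
  refine ⟨γ, hγ, m + n * k, fun v => ?_⟩
  have := h v
  rw [S.reflect_coroot α hα β hβ, hk] at this
  simp only [hw, map_sub, map_smul, smul_eq_mul, hk]
  push_cast
  linarith

lemma A0_same_side {γ : V} (hγ : γ ∈ S.R) {a b : V} (ha : a ∈ S.A0) (hb : b ∈ S.A0) (k : ℤ) :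
    0 < (S.coroot γ a - k) * (S.coroot γ b - k) := by
  have key : ∀ γ ∈ S.Rpos, ∀ k : ℤ, 0 < (S.coroot γ a - k) * (S.coroot γ b - k) := by
    intro γ hγ k
    obtain ⟨a0, a1⟩ := ha γ hγ
    obtain ⟨b0, b1⟩ := hb γ hγ
    rcases le_or_gt k 0 with h | h
    · have : (k : ℝ) ≤ 0 := by exact_mod_cast h
      exact mul_pos (by linarith) (by linarith)
    · have : (1 : ℝ) ≤ k := by exact_mod_cast h
      exact mul_pos_of_neg_of_neg (by linarith) (by linarith)
  rcases S.pos_or_neg γ hγ with h | h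
  · exact key γ h k
  · have := key _ h (-k)
    rw [S.coroot_neg γ hγ] at this
    simp only [LinearMap.neg_apply] at this
    push_cast at this
    linarith

lemma PreservesHyperplanes.same_side {g : V ≃ᵃ[ℝ] V} (hg : S.PreservesHyperplanes g)
    {β : V} (hβ : β ∈ S.R) {a b : V} (ha : a ∈ S.A0) (hb : b ∈ S.A0) (k : ℤ) :
    0 < (S.coroot β (g a) - k) * (S.coroot β (g b) - k) := by
  obtain ⟨γ, hγ, m, h⟩ := hg β hβ
  have := A0_same_side hγ ha hb (k - m)
  rw [h, h]
  push_cast at this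
  linarith

lemma pos_iff_of_mul_pos {x y : ℝ} (h : 0 < x * y) : 0 < x ↔ 0 < y :=
  ⟨fun hx => pos_of_mul_pos_right h hx.le, fun hy => pos_of_mul_pos_left h hy.le⟩

lemma neg_iff_of_mul_pos {x y : ℝ} (h : 0 < x * y) : x < 0 ↔ y < 0 :=
  ⟨fun hx => by nlinarith, fun hy => by nlinarith⟩

lemma mul_pos_trans {x y z : ℝ} (hxy : 0 < x * y) (hxz : 0 < x * z) : 0 < z * y := by
  rcases mul_pos_iff.1 hxy with ⟨s1, s2⟩ | ⟨s1, s2⟩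
  · exact mul_pos ((pos_iff_of_mul_pos hxz).1 s1) s2
  · exact mul_pos_of_neg_of_neg ((neg_iff_of_mul_pos hxz).1 s1) s2

lemma separates_iff {g : V ≃ᵃ[ℝ] V} (hg : S.PreservesHyperplanes g) {β : V} (hβ : β ∈ S.R)
    {a : V} (ha : a ∈ S.A0) (n : ℤ) :
    S.Separates β n g ↔ (S.coroot β a - n) * (S.coroot β (g a) - n) < 0 := by
  constructor
  · rintro (⟨h1, h2⟩ | ⟨h1, h2⟩)
    · exact mul_neg_of_neg_of_pos (by linarith [h1 a ha]) (by linarith [h2 a ha])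
    · exact mul_neg_of_pos_of_neg (by linarith [h1 a ha]) (by linarith [h2 a ha])
  · intro h
    have hA := fun b hb => A0_same_side hβ ha (b := b) hb n
    have hG := fun b hb => hg.same_side hβ ha (b := b) hb n
    rcases mul_neg_iff.1 h with ⟨h1, h2⟩ | ⟨h1, h2⟩
    · right
      exact ⟨fun b hb => by linarith [(pos_iff_of_mul_pos (hA b hb)).1 h1],
        fun b hb => by linarith [(neg_iff_of_mul_pos (hG b hb)).1 h2]⟩
    · left
      exact ⟨fun b hb => by linarith [(neg_iff_of_mul_pos (hA b hb)).1 h1],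
        fun b hb => by linarith [(pos_iff_of_mul_pos (hG b hb)).1 h2]⟩

variable (S) in
/-- The positive affine root hyperplanes separating the points `a` and `b`. -/
def sepSet (a b : V) : Set (V × ℤ) :=
  {q | q.1 ∈ S.Rpos ∧ (S.coroot q.1 a - q.2) * (S.coroot q.1 b - q.2) < 0}

lemma len_eq {g : V ≃ᵃ[ℝ] V} (hg : S.PreservesHyperplanes g) {a : V} (ha : a ∈ S.A0) :
    S.len g = (S.sepSet a (g a)).ncard := by
  unfold len sepSet
  congr 1
  ext q
  exact and_congr_right fun hq => separates_iff hg (S.pos_subset hq) ha _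

lemma sepSet_finite (a b : V) : (S.sepSet a b).Finite := by
  have : (⋃ γ ∈ S.Rpos, (fun k : ℤ => (γ, k)) ''
      Set.Icc ⌊min (S.coroot γ a) (S.coroot γ b)⌋ ⌈max (S.coroot γ a) (S.coroot γ b)⌉).Finite :=
    S.Rpos.finite_toSet.biUnion fun γ _ => (Set.finite_Icc _ _).image _
  refine this.subset ?_
  rintro ⟨γ, k⟩ ⟨hγ, h⟩
  simp only [Set.mem_iUnion]
  refine ⟨γ, hγ, k, ⟨?_, ?_⟩, rfl⟩
  · rw [Int.floor_le_iff]
    rcases mul_neg_iff.1 h with ⟨h1, h2⟩ | ⟨h1, h2⟩ <;> simp only at h1 h2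
    · exact (min_le_right _ _).trans_lt (by linarith)
    · exact (min_le_left _ _).trans_lt (by linarith)
  · rw [Int.le_ceil_iff]
    rcases mul_neg_iff.1 h with ⟨h1, h2⟩ | ⟨h1, h2⟩ <;> simp only at h1 h2
    · exact lt_of_lt_of_le (by linarith) (le_max_left _ _)
    · exact lt_of_lt_of_le (by linarith) (le_max_right _ _)

variable (S) in
/-- The reflection `s_{β,n}` acting on the affine root hyperplanes. -/
noncomputable def reflHyp (β : V) (n : ℤ) (q : V × ℤ) : V × ℤ :=
  (q.1 - S.coroot β q.1 • β, q.2 - ⌊S.coroot q.1 β⌋ * n)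

lemma floor_coroot {β γ : V} (hβ : β ∈ S.R) (hγ : γ ∈ S.R) :
    (⌊S.coroot γ β⌋ : ℝ) = S.coroot γ β := by
  obtain ⟨k, hk⟩ := S.crystallographic γ hγ β hβ
  simp [hk]

lemma reflHyp_mem {β : V} (hβ : β ∈ S.R) (n : ℤ) {q : V × ℤ} (hq : q.1 ∈ S.R) :
    (S.reflHyp β n q).1 ∈ S.R := S.reflect_root β hβ _ hq

lemma reflHyp_apply {β : V} (hβ : β ∈ S.R) (n : ℤ) {q : V × ℤ} (hq : q.1 ∈ S.R) (v : V) :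
    S.coroot (S.reflHyp β n q).1 v - (S.reflHyp β n q).2 =
      (S.coroot q.1 v - q.2) - S.coroot q.1 β * (S.coroot β v - n) := by
  simp only [reflHyp]
  rw [S.reflect_coroot β hβ _ hq]
  push_cast
  rw [floor_coroot hβ hq]
  ring

lemma reflHyp_apply_refl {β : V} (hβ : β ∈ S.R) (n : ℤ) {q : V × ℤ} (hq : q.1 ∈ S.R) (v : V) :
    S.coroot (S.reflHyp β n q).1 (v - (S.coroot β v - n) • β) - (S.reflHyp β n q).2 =
      S.coroot q.1 v - q.2 := by
  rw [reflHyp_apply hβ n hq]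
  simp only [map_sub, map_smul, smul_eq_mul, S.coroot_self β hβ]
  ring

lemma reflHyp_neg {β : V} (n : ℤ) {q : V × ℤ} (hβ : β ∈ S.R) (hq : q.1 ∈ S.R) :
    S.reflHyp β n (-q) = -S.reflHyp β n q := by
  have h : (⌊S.coroot (-q.1) β⌋ : ℤ) = -⌊S.coroot q.1 β⌋ := by
    rw [S.coroot_neg _ hq, LinearMap.neg_apply, ← floor_coroot hβ hq, ← Int.cast_neg,
      Int.floor_intCast, Int.floor_intCast]
  ext
  · simp only [reflHyp, Prod.fst_neg, map_neg]
    module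
  · simp only [reflHyp, Prod.fst_neg, Prod.snd_neg, h]
    ring

lemma reflHyp_reflHyp {β : V} (n : ℤ) {q : V × ℤ} (hβ : β ∈ S.R) (hq : q.1 ∈ S.R) :
    S.reflHyp β n (S.reflHyp β n q) = q := by
  refine Prod.ext (S.reflect_reflect hβ) ?_
  have h := reflHyp_apply hβ n (reflHyp_mem hβ n hq) 0
  rw [reflHyp_apply hβ n hq 0] at h
  simp only [map_zero] at h
  have h3 : S.coroot (S.reflHyp β n q).1 β = - S.coroot q.1 β := by
    simp only [reflHyp]
    rw [S.reflect_coroot β hβ _ hq, S.coroot_self β hβ]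
    ring
  rw [h3] at h
  have : ((S.reflHyp β n (S.reflHyp β n q)).2 : ℝ) = q.2 := by linarith
  exact_mod_cast this

lemma coroot_neg_sub {q : V × ℤ} (hq : q.1 ∈ S.R) (v : V) :
    S.coroot (-q).1 v - ((-q).2 : ℤ) = -(S.coroot q.1 v - q.2) := by
  simp only [Prod.fst_neg, Prod.snd_neg, S.coroot_neg _ hq, LinearMap.neg_apply]
  push_cast
  ring

lemma sepSet_ncard_lt {β : V} (hβ : β ∈ S.Rpos) {n : ℤ} {a b : V}
    (hab : 0 < (S.coroot β a - n) * (S.coroot β b - n))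
    (hgen : ∀ γ ∈ S.Rpos, ∀ k : ℤ, S.coroot γ a ≠ k ∧
      S.coroot γ (b - (S.coroot β b - n) • β) ≠ k) :
    (S.sepSet a b).ncard < (S.sepSet a (b - (S.coroot β b - n) • β)).ncard := by
  set b' := b - (S.coroot β b - n) • β with hb'
  have hβR := S.pos_subset hβ
  have hb'β : S.coroot β b' - n = -(S.coroot β b - n) := by
    simp only [hb', map_sub, map_smul, smul_eq_mul, S.coroot_self β hβR]
    ring
  rw [Set.ncard_lt_ncard_iff_ncard_sdiff_lt_ncard_sdiff (sepSet_finite _ _) (sepSet_finite _ _)]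
  let φ : V × ℤ → V × ℤ := fun q =>
    if (S.reflHyp β n q).1 ∈ S.Rpos then S.reflHyp β n q else -S.reflHyp β n q
  have hφ : ∀ q, φ q = S.reflHyp β n q ∨ φ q = -S.reflHyp β n q := fun q => by
    by_cases h : (S.reflHyp β n q).1 ∈ S.Rpos
    · exact Or.inl (if_pos h)
    · exact Or.inr (if_neg h)
  have hφpos : ∀ q : V × ℤ, q.1 ∈ S.R → (φ q).1 ∈ S.Rpos := fun q hq => by
    by_cases h : (S.reflHyp β n q).1 ∈ S.Rpos
    · simp only [φ, if_pos h, h]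
    · simp only [φ, if_neg h]
      exact (S.pos_or_neg _ (reflHyp_mem hβR n hq)).resolve_left h
  have hφmul : ∀ q : V × ℤ, q.1 ∈ S.R → ∀ x y,
      (S.coroot (φ q).1 x - (φ q).2) * (S.coroot (φ q).1 y - (φ q).2) =
      (S.coroot (S.reflHyp β n q).1 x - (S.reflHyp β n q).2) *
      (S.coroot (S.reflHyp β n q).1 y - (S.reflHyp β n q).2) := fun q hq x y => by
    rcases hφ q with h | h
    · rw [h]
    · rw [h, coroot_neg_sub (reflHyp_mem hβR n hq), coroot_neg_sub (reflHyp_mem hβR n hq)]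
      ring
  have hinv : ∀ q ∈ S.sepSet a b \ S.sepSet a b', S.reflHyp β n (φ q) = q ∨
      S.reflHyp β n (φ q) = -q := fun q hq => by
    have hqR := S.pos_subset hq.1.1
    rcases hφ q with h | h
    · left; rw [h, reflHyp_reflHyp n hβR hqR]
    · right; rw [h, reflHyp_neg n hβR (reflHyp_mem hβR n hqR), reflHyp_reflHyp n hβR hqR]
  have hinj : Set.InjOn φ (S.sepSet a b \ S.sepSet a b') := by
    intro q hq q' hq' he
    have h1 := hinv q hq
    have h2 := hinv q' hq'
    rw [← he] at h2
    have hne : ∀ r ∈ S.Rpos, ∀ r' ∈ S.Rpos, r ≠ -r' := fun r hr r' hr' h => by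
      exact S.pos_not_neg r' hr' (h ▸ hr)
    rcases h1 with h1 | h1 <;> rcases h2 with h2 | h2 <;> rw [h1] at h2
    · exact h2
    · exact absurd (congrArg Prod.fst h2) (hne _ hq.1.1 _ hq'.1.1)
    · exact absurd (congrArg Prod.fst h2).symm (hne _ hq'.1.1 _ hq.1.1)
    · exact neg_injective h2
  have hsigns : ∀ q ∈ S.sepSet a b \ S.sepSet a b',
      φ q ∈ S.sepSet a b' \ S.sepSet a b := by
    rintro q ⟨⟨hq, h1⟩, h2⟩
    have hqR := S.pos_subset hq
    obtain ⟨ga, gb⟩ := hgen _ hq q.2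
    have h2' : 0 < (S.coroot q.1 a - q.2) * (S.coroot q.1 b' - q.2) := by
      refine lt_of_le_of_ne (not_lt.1 fun h => h2 ⟨hq, h⟩) ?_
      exact (mul_ne_zero (sub_ne_zero.2 ga) (sub_ne_zero.2 gb)).symm
    have eb : S.coroot (S.reflHyp β n q).1 b' - (S.reflHyp β n q).2 =
      S.coroot q.1 b - q.2 := reflHyp_apply_refl hβR n hqR b
    have ebb : S.coroot (S.reflHyp β n q).1 b - (S.reflHyp β n q).2 =
      S.coroot q.1 b' - q.2 := by
      rw [reflHyp_apply hβR n hqR, hb']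
      simp only [map_sub, map_smul, smul_eq_mul]
      ring
    have eb2 := reflHyp_apply hβR n hqR b
    have ea := reflHyp_apply hβR n hqR a
    have hga : 0 < (S.coroot q.1 a - q.2) *
        (S.coroot (S.reflHyp β n q).1 a - (S.reflHyp β n q).2) := by
      rw [ea]
      rw [ebb] at eb2
      rw [eb2] at h2'
      generalize S.coroot q.1 a - (q.2 : ℝ) = x at *
      generalize S.coroot q.1 b - (q.2 : ℝ) = y at *
      generalize S.coroot β a - (n : ℝ) = s at *
      generalize S.coroot β b - (n : ℝ) = t at *
      generalize S.coroot q.1 β = g at *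
      have hxgt : 0 < -(x * (g * t)) := by nlinarith
      have hxgs : 0 < -(x * g * s) := by
        have h3 : 0 < (-(x * g * s)) * (t * t) := by nlinarith
        exact pos_of_mul_pos_left h3 (mul_self_nonneg t)
      have hx : 0 < x * x := mul_self_pos.2 (by rintro rfl; simp at h1)
      nlinarith
    have hneg : (S.coroot (φ q).1 a - (φ q).2) * (S.coroot (φ q).1 b' - (φ q).2) < 0 := by
      rw [hφmul q hqR, eb]
      rcases mul_neg_iff.1 h1 with ⟨p1, p2⟩ | ⟨p1, p2⟩
      · exact mul_neg_of_pos_of_neg ((pos_iff_of_mul_pos hga).1 p1) p2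
      · exact mul_neg_of_neg_of_pos ((neg_iff_of_mul_pos hga).1 p1) p2
    have hpos : 0 < (S.coroot (φ q).1 a - (φ q).2) * (S.coroot (φ q).1 b - (φ q).2) := by
      rw [hφmul q hqR, ebb]
      rcases mul_neg_iff.1 h1 with ⟨p1, p2⟩ | ⟨p1, p2⟩
      · exact mul_pos ((pos_iff_of_mul_pos hga).1 p1) ((pos_iff_of_mul_pos h2').1 p1)
      · exact mul_pos_of_neg_of_neg ((neg_iff_of_mul_pos hga).1 p1)
          ((neg_iff_of_mul_pos h2').1 p1)
    exact ⟨⟨hφpos q hqR, hneg⟩, fun h => absurd h.2 hpos.not_gt⟩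
  have hfin : (S.sepSet a b' \ S.sepSet a b).Finite := (sepSet_finite _ _).sdiff
  rw [← hinj.ncard_image]
  refine Set.ncard_lt_ncard ⟨Set.image_subset_iff.2 hsigns, fun hsub => ?_⟩ hfin
  have hmem : ((β, n) : V × ℤ) ∈ S.sepSet a b' \ S.sepSet a b := by
    refine ⟨⟨hβ, ?_⟩, fun h => absurd h.2 hab.not_gt⟩
    simp only [hb'β]
    linarith
  obtain ⟨q, hq, he⟩ := hsub hmem
  have hqR := S.pos_subset hq.1.1
  have h1 := hφmul q hqR (a - (S.coroot β a - n) • β) (b - (S.coroot β b - n) • β)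
  rw [reflHyp_apply_refl hβR n hqR, reflHyp_apply_refl hβR n hqR, he] at h1
  simp only [map_sub, map_smul, smul_eq_mul, S.coroot_self β hβR] at h1
  have h2 := hq.1.2
  rw [← h1] at h2
  nlinarith

lemma len_lt_of_same_side {u w : V ≃ᵃ[ℝ] V} (hu : S.PreservesHyperplanes u) {β : V}
    (hβ : β ∈ S.R) {n : ℤ} (hw : ∀ x, w x = u x - (S.coroot β (u x) - (n : ℝ)) • β)
    {a : V} (ha : a ∈ S.A0) (h : 0 < (S.coroot β a - n) * (S.coroot β (u a) - n)) :
    S.len u < S.len w := by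
  wlog hpos : β ∈ S.Rpos generalizing β n
  · refine this (S.neg_mem β hβ) (n := -n) (fun x => ?_) ?_
      ((S.pos_or_neg β hβ).resolve_left hpos)
    · rw [hw, S.coroot_neg β hβ, LinearMap.neg_apply]
      push_cast
      module
    · simp only [S.coroot_neg β hβ, LinearMap.neg_apply]
      push_cast
      linarith
  have hw' := hu.reflect hβ hw
  rw [len_eq hu ha, len_eq hw' ha, hw]
  refine sepSet_ncard_lt hpos h fun γ hγ k => ?_
  have hγR := S.pos_subset hγ
  have h1 := A0_same_side hγR ha ha k
  have h2 := hw'.same_side hγR ha ha k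
  rw [hw] at h2
  exact ⟨fun e => by simp [e] at h1, fun e => by rw [e] at h2; simp at h2⟩

variable (S) in
/-- One step of the Bruhat order relative to a base point `c`: the alcove `u(A₀) ∋ u(a)` is
reflected in a hyperplane which does not separate it from `c`. -/
def StepFrom (c a : V) (u w : V ≃ᵃ[ℝ] V) : Prop :=
  ∃ β ∈ S.R, ∃ n : ℤ, (∀ x, w x = u x - (S.coroot β (u x) - (n : ℝ)) • β) ∧
    0 < (S.coroot β c - n) * (S.coroot β (u a) - n)

variable (S) in
/-- The Bruhat order relative to a base point `c`. -/
def LEFrom (c a : V) : (V ≃ᵃ[ℝ] V) → (V ≃ᵃ[ℝ] V) → Prop :=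
  Relation.ReflTransGen (S.StepFrom c a)

variable (S) in
/-- The affine reflection `s_{β,n}`. -/
noncomputable def affReflection {β : V} (hβ : β ∈ S.R) (n : ℤ) : V ≃ᵃ[ℝ] V :=
  S.trans ((n : ℝ) • β) * S.ofW (Module.reflection (S.coroot_self β hβ))

lemma affReflection_apply {β : V} (hβ : β ∈ S.R) (n : ℤ) (x : V) :
    S.affReflection hβ n x = x - (S.coroot β x - n) • β := by
  have : S.affReflection hβ n x =
    (n : ℝ) • β + Module.reflection (S.coroot_self β hβ) x := rfl
  rw [this, Module.reflection_apply]
  module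

lemma affReflection_involutive {β : V} (hβ : β ∈ S.R) (n : ℤ) (x : V) :
    S.affReflection hβ n (S.affReflection hβ n x) = x := by
  simp only [affReflection_apply, map_sub, map_smul, smul_eq_mul, S.coroot_self β hβ]
  module

/-- Moving the base point across a single hyperplane `⟨·,β∨⟩ = n`, which it meets in `d`. -/
lemma LEFrom.cross {c c' d a : V} {β : V} (hβ : β ∈ S.R) {n : ℤ}
    (hd : S.coroot β d = n)
    (hgen : ∀ q : V × ℤ, q.1 ∈ S.R → q = (β, n) ∨ q = -(β, n) ∨
      (0 < (S.coroot q.1 d - q.2) * (S.coroot q.1 c - q.2) ∧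
        0 < (S.coroot q.1 d - q.2) * (S.coroot q.1 c' - q.2)))
    {x y : V ≃ᵃ[ℝ] V} (hx : 0 < (S.coroot β c' - n) * (S.coroot β (x a) - n))
    (hxy : S.LEFrom c a x y) : S.LEFrom c' a x y := by
  suffices h : S.LEFrom c' a x y ∧ S.LEFrom c' a x (S.affReflection hβ n * y) from h.1
  have hmul : ∀ (g : V ≃ᵃ[ℝ] V) v,
      (S.affReflection hβ n * g) v = g v - (S.coroot β (g v) - n) • β :=
    fun g v => affReflection_apply hβ n (g v)
  induction hxy with
  | refl => exact ⟨.refl, .single ⟨β, hβ, n, hmul x, hx⟩⟩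
  | @tail z w _ hzw ih =>
    obtain ⟨γ, hγ, k, hw, hs⟩ := hzw
    have hswap : (∀ v, w v = z v - (S.coroot β (z v) - n) • β) →
        S.LEFrom c' a x w ∧ S.LEFrom c' a x (S.affReflection hβ n * w) := fun h => by
      have e1 : w = S.affReflection hβ n * z := AffineEquiv.ext fun v => by rw [h, hmul]
      have e2 : S.affReflection hβ n * w = z := by
        rw [e1]
        exact AffineEquiv.ext fun v => affReflection_involutive hβ n (z v)
      exact ⟨e1 ▸ ih.2, e2.symm ▸ ih.1⟩
    rcases hgen (γ, k) hγ with h | h | ⟨h1, h2⟩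
    · obtain ⟨rfl, rfl⟩ := Prod.mk.inj h
      exact hswap hw
    · obtain ⟨rfl, rfl⟩ := Prod.mk.inj (show (γ, k) = (-β, -n) from h)
      refine hswap fun v => ?_
      rw [hw, S.coroot_neg β hβ, LinearMap.neg_apply]
      push_cast
      module
    · simp only at h1 h2
      have hdz : 0 < (S.coroot γ d - k) * (S.coroot γ (z a) - k) :=
        mul_pos_trans hs (by rwa [mul_comm])
      refine ⟨ih.1.tail ⟨γ, hγ, k, hw, mul_pos_trans hdz h2⟩, ih.2.tail ?_⟩
      have hr := fun v => reflHyp_apply_refl hβ n (q := (γ, k)) hγ v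
      have hrd : S.coroot (S.reflHyp β n (γ, k)).1 d - (S.reflHyp β n (γ, k)).2 =
          S.coroot γ d - k := by
        rw [reflHyp_apply hβ n (q := (γ, k)) hγ, hd]; simp
      refine ⟨(S.reflHyp β n (γ, k)).1, reflHyp_mem hβ n hγ, (S.reflHyp β n (γ, k)).2,
        fun v => ?_, ?_⟩
      · rw [hmul z, hr, hmul w, hw]
        simp only [reflHyp, map_sub, map_smul, smul_eq_mul]
        module
      · rw [hmul z, hr]
        refine mul_pos_trans (x := S.coroot γ d - k) hdz ?_
        have hne : S.coroot γ d - k ≠ 0 := fun e => by simp [e] at hdz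
        have key := hgen (S.reflHyp β n (γ, k)) (reflHyp_mem hβ n hγ)
        rw [hrd] at key
        rcases key with h | h | h
        · rw [h] at hrd
          simp only [hd, sub_self] at hrd
          exact absurd hrd.symm hne
        · rw [h, coroot_neg_sub (q := (β, n)) hβ] at hrd
          simp only [hd, sub_self, neg_zero] at hrd
          exact absurd hrd.symm hne
        · exact h.2

lemma LEFrom.congr {c c' a : V}
    (h : ∀ γ ∈ S.R, ∀ k : ℤ, 0 < (S.coroot γ c - k) * (S.coroot γ c' - k))
    {x y : V ≃ᵃ[ℝ] V} (hxy : S.LEFrom c a x y) : S.LEFrom c' a x y := by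
  induction hxy with
  | refl => exact .refl
  | tail _ hstep ih =>
    obtain ⟨γ, hγ, k, hw, hs⟩ := hstep
    exact ih.tail ⟨γ, hγ, k, hw, mul_pos_trans hs (h γ hγ k)⟩

/-- Positive roots with proportional coroots are equal. -/
lemma eq_of_coroot_eq_mul {γ γ' : V} (hγ : γ ∈ S.Rpos) (hγ' : γ' ∈ S.Rpos) {c : ℝ}
    (h : ∀ x, S.coroot γ x = c * S.coroot γ' x) : γ = γ' := by
  have hR := S.pos_subset hγ
  have hR' := S.pos_subset hγ'
  have h2 := S.coroot_self γ hR
  have h2' := S.coroot_self γ' hR'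
  have hcc : c * S.coroot γ' γ = 2 := by rw [← h, h2]
  have hc : c ≠ 0 := by rintro rfl; simp at hcc
  set v := γ - c⁻¹ • γ' with hv
  have hv0 : S.coroot γ' v = 0 := by
    simp only [hv, map_sub, map_smul, smul_eq_mul, h2']
    field_simp
    linarith
  have hmem : ∀ n : ℕ, γ' + (2 * c * n) • v ∈ S.R := by
    intro n
    induction n with
    | zero => simpa using hR'
    | succ n ih =>
      have h1 := S.reflect_root γ hR _ (S.reflect_root γ' hR' _ ih)
      convert h1 using 1
      simp only [h, map_sub, map_add, map_smul, smul_eq_mul, h2', hv0]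
      push_cast
      have : γ = v + c⁻¹ • γ' := by rw [hv]; module
      rw [this]
      match_scalars <;> field_simp <;> ring
  have hv' : v = 0 := by
    by_contra hne
    have hinj : Function.Injective fun n : ℕ => γ' + (2 * c * n) • v := fun m n hmn => by
      have h1 := smul_left_injective ℝ hne (add_left_cancel hmn)
      have h3 := mul_left_cancel₀ (mul_ne_zero two_ne_zero hc) h1
      exact_mod_cast h3
    exact Set.infinite_of_injective_forall_mem hinj hmem S.R.finite_toSet
  have hγe : γ = c⁻¹ • γ' := sub_eq_zero.1 hv'
  rcases S.reduced γ' hR' c⁻¹ (hγe ▸ hR) with h1 | h1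
  · rw [hγe, h1, one_smul]
  · rw [h1, neg_one_smul] at hγe
    exact absurd (hγe ▸ hγ) (S.pos_not_neg γ' hγ')

/-- A point of the alcove `w₀(A₀)` such that the line through it in the direction `η` meets the
affine root hyperplanes one at a time. -/
lemma exists_generic {q₀ : V} (h₀ : ∀ γ ∈ S.Rpos, -1 < S.coroot γ q₀ ∧ S.coroot γ q₀ < 0) :
    ∃ q : V, (∀ γ ∈ S.Rpos, -1 < S.coroot γ q ∧ S.coroot γ q < 0) ∧
      ∀ γ ∈ S.Rpos, ∀ γ' ∈ S.Rpos, γ ≠ γ' → ∀ k k' : ℤ,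
        (S.coroot γ q - k) * S.coroot γ' S.eta ≠ (S.coroot γ' q - k') * S.coroot γ S.eta := by
  let I := {r : S.Rpos × S.Rpos // (r.1 : V) ≠ r.2}
  let f : I → Module.Dual ℝ V := fun r =>
    S.coroot r.1.2 S.eta • S.coroot r.1.1 - S.coroot r.1.1 S.eta • S.coroot r.1.2
  obtain ⟨d, hd⟩ := Module.Dual.exists_forall_ne_zero_of_forall_exists f fun r => by
    by_contra! hr
    have hη := S.coroot_eta_pos r.1.2.2
    refine r.2 (eq_of_coroot_eq_mul r.1.1.2 r.1.2.2
      (c := S.coroot r.1.1 S.eta / S.coroot r.1.2 S.eta) fun x => ?_)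
    have := hr x
    simp only [f, LinearMap.sub_apply, LinearMap.smul_apply, smul_eq_mul] at this
    field_simp
    linarith
  let bad : Set ℝ := ⋃ (r : I) (k : ℤ) (k' : ℤ), {ε |
    (S.coroot r.1.1 (q₀ + ε • d) - k) * S.coroot r.1.2 S.eta =
      (S.coroot r.1.2 (q₀ + ε • d) - k') * S.coroot r.1.1 S.eta}
  have hbad : bad.Countable := by
    refine Set.countable_iUnion fun r => Set.countable_iUnion fun k =>
      Set.countable_iUnion fun k' => Set.Subsingleton.countable ?_
    intro ε hε ε' hε'
    have h1 := hd r
    simp only [Set.mem_ofPred_eq, map_add, map_smul, smul_eq_mul] at hε hε'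
    simp only [f, LinearMap.sub_apply, LinearMap.smul_apply, smul_eq_mul] at h1
    refine mul_right_cancel₀ h1 ?_
    linarith
  have hnear : ∀ᶠ ε : ℝ in nhds 0, ∀ γ ∈ S.Rpos,
      -1 < S.coroot γ (q₀ + ε • d) ∧ S.coroot γ (q₀ + ε • d) < 0 := by
    rw [Filter.eventually_all_finset]
    intro γ hγ
    have hcont : Continuous fun ε : ℝ => S.coroot γ q₀ + ε * S.coroot γ d := by fun_prop
    have hopen := (isOpen_Ioo (a := (-1 : ℝ)) (b := 0)).preimage hcont
    filter_upwards [hopen.mem_nhds (by simpa using h₀ γ hγ)] with ε hε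
    simpa using hε
  obtain ⟨ε, hε, hε'⟩ := (hbad.dense_compl ℝ).inter_nhds_nonempty hnear
  refine ⟨q₀ + ε • d, hε', fun γ hγ γ' hγ' hne k k' he => hε ?_⟩
  simp only [bad, Set.mem_iUnion]
  exact ⟨⟨(⟨γ, hγ⟩, ⟨γ', hγ'⟩), hne⟩, k, k', he⟩

lemma mul_pos_of_forall_ne_zero {x y s t : ℝ} (h : ∀ τ ∈ Set.uIcc s t, x - τ * y ≠ 0) :
    0 < (x - s * y) * (x - t * y) := by
  by_contra! hle
  have hcont : ContinuousOn (fun τ => x - τ * y) (Set.uIcc s t) := by fun_prop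
  have h0 : (0 : ℝ) ∈ Set.uIcc (x - s * y) (x - t * y) := by
    rw [Set.mem_uIcc]
    rcases mul_nonpos_iff.1 hle with h | h
    · exact Or.inr ⟨h.2, h.1⟩
    · exact Or.inl h
  obtain ⟨τ, hτ, h1⟩ := intermediate_value_uIcc hcont h0
  exact h τ hτ h1

variable (S) in
/-- The times at which the line `τ ↦ q - τη` meets an affine root hyperplane. -/
def crossingTimes (q : V) : Set ℝ :=
  {τ | ∃ γ ∈ S.Rpos, ∃ k : ℤ, S.coroot γ (q - τ • S.eta) = k}

lemma crossingTimes_finite (q : V) (t : ℝ) :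
    (S.crossingTimes q ∩ Set.Icc 0 t).Finite := by
  have : (⋃ γ ∈ S.Rpos, (fun k : ℤ => (S.coroot γ q - k) / S.coroot γ S.eta) ''
      Set.Icc ⌊S.coroot γ q - t * S.coroot γ S.eta⌋ ⌈S.coroot γ q⌉).Finite :=
    S.Rpos.finite_toSet.biUnion fun γ _ => (Set.finite_Icc _ _).image _
  refine this.subset ?_
  rintro τ ⟨⟨γ, hγ, k, hk⟩, h0, h1⟩
  have hη := S.coroot_eta_pos hγ
  rw [map_sub, map_smul, smul_eq_mul] at hk
  simp only [Set.mem_iUnion]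
  refine ⟨γ, hγ, k, ⟨?_, ?_⟩, ?_⟩
  · have : ((⌊S.coroot γ q - t * S.coroot γ S.eta⌋ : ℤ) : ℝ) ≤ k :=
      (Int.floor_le _).trans (by nlinarith)
    exact_mod_cast this
  · have : (k : ℝ) ≤ ⌈S.coroot γ q⌉ := le_trans (by nlinarith) (Int.le_ceil _)
    exact_mod_cast this
  · simp only
    field_simp
    linarith

lemma exists_pos_hyperplane {γ : V} (hγ : γ ∈ S.R) {k : ℤ} {v : V} (h : S.coroot γ v = k) :
    ∃ q : V × ℤ, q.1 ∈ S.Rpos ∧ S.coroot q.1 v = q.2 ∧ ((γ, k) = q ∨ (γ, k) = -q) := by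
  rcases S.pos_or_neg γ hγ with h1 | h1
  · exact ⟨(γ, k), h1, h, Or.inl rfl⟩
  · refine ⟨-(γ, k), h1, ?_, Or.inr (neg_neg _).symm⟩
    have := coroot_neg_sub (q := (γ, k)) hγ v
    simp only [h, sub_self, neg_zero] at this
    exact sub_eq_zero.1 this

/-- If `τ ↦ q - τη` does not meet a hyperplane between the times `s` and `t`, the points at
these times lie on the same side of it. -/
lemma same_side_of_no_crossing {q γ : V} {k : ℤ} {s t : ℝ}
    (h : ∀ τ ∈ Set.uIcc s t, S.coroot γ (q - τ • S.eta) ≠ k) :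
    0 < (S.coroot γ (q - s • S.eta) - k) * (S.coroot γ (q - t • S.eta) - k) := by
  have := mul_pos_of_forall_ne_zero (x := S.coroot γ q - k) (y := S.coroot γ S.eta)
    (s := s) (t := t) fun τ hτ h0 => h τ hτ (by
      rw [map_sub, map_smul, smul_eq_mul]; linarith)
  simp only [map_sub, map_smul, smul_eq_mul]
  convert this using 2 <;> ring

lemma LEFrom.ascend {q a : V} (hq : ∀ γ ∈ S.Rpos, -1 < S.coroot γ q ∧ S.coroot γ q < 0)
    (hgen : ∀ γ ∈ S.Rpos, ∀ γ' ∈ S.Rpos, γ ≠ γ' → ∀ k k' : ℤ,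
      (S.coroot γ q - k) * S.coroot γ' S.eta ≠ (S.coroot γ' q - k') * S.coroot γ S.eta)
    {x y : V ≃ᵃ[ℝ] V} (hx : ∀ γ ∈ S.Rpos, 0 < S.coroot γ (x a)) {t : ℝ} (ht : 0 ≤ t)
    (htF : t ∉ S.crossingTimes q) (hxy : S.LEFrom (q - t • S.eta) a x y) :
    S.LEFrom q a x y := by
  induction hN : (S.crossingTimes q ∩ Set.Icc 0 t).ncard using Nat.strong_induction_on
    generalizing t with
  | _ N ih =>
  subst hN
  have hmemF : ∀ {γ : V} {k : ℤ} {τ : ℝ}, γ ∈ S.R → S.coroot γ (q - τ • S.eta) = k →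
      τ ∈ S.crossingTimes q := fun hγ h => by
    obtain ⟨r, hr, h1, -⟩ := exists_pos_hyperplane hγ h
    exact ⟨r.1, hr, r.2, h1⟩
  rcases (S.crossingTimes q ∩ Set.Icc 0 t).eq_empty_or_nonempty with hF | hF
  · have h0 : q = q - (0 : ℝ) • S.eta := by simp
    rw [h0]
    refine hxy.congr fun γ hγ k => same_side_of_no_crossing fun τ hτ he => ?_
    rw [Set.uIcc_of_ge ht] at hτ
    exact hF.subset ⟨hmemF hγ he, hτ⟩
  · obtain ⟨t', ⟨ht'F, ht'0, ht't⟩, hmax⟩ :=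
      Set.exists_max_image _ id (crossingTimes_finite q t) hF
    simp only [id] at hmax
    obtain ⟨β, hβ, n, hn⟩ := ht'F
    have hβR := S.pos_subset hβ
    have hηβ := S.coroot_eta_pos hβ
    have hnβ : S.coroot β q - t' * S.coroot β S.eta = n := by
      simpa only [map_sub, map_smul, smul_eq_mul] using hn
    have hn0 : (n : ℝ) < 0 := by nlinarith [(hq β hβ).2]
    have ht'pos : 0 < t' := by
      refine lt_of_le_of_ne ht'0 ?_
      rintro rfl
      have h1 := hq β hβ
      simp only [zero_mul, sub_zero] at hnβ
      rw [hnβ] at h1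
      have h2 : -1 < n := by exact_mod_cast h1.1
      have h3 : n < 0 := by exact_mod_cast h1.2
      omega
    obtain ⟨s, ⟨hs0, hst⟩, hs⟩ : ∃ s, (0 ≤ s ∧ s < t') ∧
        ∀ τ ∈ S.crossingTimes q, 0 ≤ τ → τ < t' → τ ≤ s := by
      have hfin : (insert 0 (S.crossingTimes q ∩ Set.Ico 0 t')).Finite :=
        ((crossingTimes_finite q t').subset
          (Set.inter_subset_inter_right _ Set.Ico_subset_Icc_self)).insert 0
      obtain ⟨s, hs, hsmax⟩ := Set.exists_max_image _ id hfin (Set.insert_nonempty _ _)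
      refine ⟨s, ?_, fun τ h1 h2 h3 => hsmax τ (Set.mem_insert_of_mem _ ⟨h1, h2, h3⟩)⟩
      rcases hs with rfl | hs
      · exact ⟨le_rfl, ht'pos⟩
      · exact hs.2
    obtain ⟨t'', h1, h2⟩ := exists_between hst
    have ht''F : t'' ∉ S.crossingTimes q := fun h => (hs t'' h (hs0.trans h1.le) h2).not_gt h1
    refine ih _ ?_ (hs0.trans h1.le) ht''F ?_ rfl
    · refine Set.ncard_lt_ncard ⟨fun τ hτ => ⟨hτ.1, hτ.2.1, ?_⟩, fun hsub => ?_⟩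
        (crossingTimes_finite q t)
      · exact hτ.2.2.trans (h2.le.trans ht't)
      · exact (hsub ⟨⟨β, hβ, n, hn⟩, ht'0, ht't⟩ : _ ∧ _).2.2.not_gt h2
    · refine hxy.cross hβR hn (fun r hr => ?_) ?_
      · by_cases hrd : S.coroot r.1 (q - t' • S.eta) = r.2
        · obtain ⟨r', hr', he, hor⟩ := exists_pos_hyperplane hr hrd
          have hrβ : r' = (β, n) := by
            have he' := he
            simp only [map_sub, map_smul, smul_eq_mul] at he'
            have h3 : r'.1 = β := by
              by_contra hne
              refine hgen _ hr' _ hβ hne r'.2 n ?_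
              rw [← he', ← hnβ]
              ring
            refine Prod.ext h3 ?_
            rw [h3, hn] at he
            exact_mod_cast he.symm
          rw [hrβ] at hor
          rcases hor with h | h
          · exact Or.inl h
          · exact Or.inr (Or.inl h)
        · refine Or.inr (Or.inr ⟨?_, ?_⟩)
          · refine same_side_of_no_crossing fun τ hτ he => ?_
            rw [Set.uIcc_of_le ht't] at hτ
            have := hmax τ ⟨hmemF hr he, ht'0.trans hτ.1, hτ.2⟩
            obtain rfl := le_antisymm this hτ.1
            exact hrd he
          · refine same_side_of_no_crossing fun τ hτ he => ?_
            rw [Set.uIcc_of_ge h2.le] at hτ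
            rcases hτ.2.lt_or_eq with h | rfl
            · exact (hs τ (hmemF hr he) (hs0.trans (h1.le.trans hτ.1)) h).not_gt
                (h1.trans_le hτ.1)
            · exact hrd he
      · refine mul_pos ?_ (by linarith [hx β hβ])
        simp only [map_sub, map_smul, smul_eq_mul]
        nlinarith

lemma eventually_LEFrom_of_upLE {a : V} (ha : a ∈ S.A0) (q : V) {x y : V ≃ᵃ[ℝ] V}
    (h : S.upLE x y) : ∃ T : ℝ, ∀ t ≥ T, S.LEFrom (q - t • S.eta) a x y := by
  induction h with
  | refl => exact ⟨0, fun _ _ => .refl⟩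
  | tail _ hstep ih =>
    obtain ⟨T, hT⟩ := ih
    obtain ⟨α, hα, n, hw, hlow⟩ := hstep
    have hη := S.coroot_eta_pos hα
    refine ⟨max T ((S.coroot α q - n) / S.coroot α S.eta + 1), fun t ht =>
      (hT t (le_of_max_le_left ht)).tail ⟨α, S.pos_subset hα, n, hw, ?_⟩⟩
    refine mul_pos_of_neg_of_neg ?_ (by linarith [hlow a ha])
    have h1 : (S.coroot α q - n) / S.coroot α S.eta < t := by linarith [le_of_max_le_right ht]
    rw [div_lt_iff₀ hη] at h1
    rw [map_sub, map_smul, smul_eq_mul]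
    linarith

lemma bruhatLE_of_LEFrom {q a : V} (ha : a ∈ S.A0) {g : V ≃ₗ[ℝ] V} (hg : g ∈ S.Weyl)
    (hgq : g q ∈ S.A0) {x y : V ≃ᵃ[ℝ] V} (hx : S.PreservesHyperplanes x)
    (h : S.LEFrom q a x y) : S.bruhatLE (S.ofW g * x) (S.ofW g * y) := by
  suffices H : S.bruhatLE (S.ofW g * x) (S.ofW g * y) ∧ S.PreservesHyperplanes y from H.1
  induction h with
  | refl => exact ⟨.refl, hx⟩
  | @tail u w _ hstep ih =>
    obtain ⟨β, hβ, n, hw, hs⟩ := hstep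
    refine ⟨ih.1.tail ?_, ih.2.reflect hβ hw⟩
    obtain ⟨hgβ, hgc⟩ := S.weyl_root hg β hβ
    have happ : ∀ (v : V ≃ᵃ[ℝ] V) z, (S.ofW g * v) z = g (v z) := fun _ _ => rfl
    have hw' : ∀ z, (S.ofW g * w) z = (S.ofW g * u) z -
        (S.coroot (g β) ((S.ofW g * u) z) - n) • g β := fun z => by
      rw [happ, happ, hw, hgc, map_sub, map_smul]
    have hu : S.PreservesHyperplanes (S.ofW g * u) := fun γ hγ => by
      obtain ⟨h1, h2⟩ := S.weyl_root (inv_mem hg) γ hγ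
      obtain ⟨δ, hδ, m, h3⟩ := ih.2 _ h1
      refine ⟨δ, hδ, m, fun v => ?_⟩
      have e : g⁻¹ (g (u v)) = u v := g.symm_apply_apply _
      rw [happ, ← h2, e, h3]
    refine ⟨⟨S.affReflection hgβ n, ⟨g β, hgβ, n, affReflection_apply hgβ n⟩,
      AffineEquiv.ext fun z => ?_⟩, len_lt_of_same_side hu hgβ hw' ha ?_⟩
    · rw [hw']
      exact (affReflection_apply hgβ n _).symm
    · rw [happ, hgc]
      rw [← hgc q] at hs
      exact mul_pos_trans hs (A0_same_side hgβ hgq ha n)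

lemma w0_inv_neg {γ : V} (hγ : γ ∈ S.Rpos) : -(S.w0⁻¹ γ) ∈ S.Rpos := by
  have h := (S.weyl_root (inv_mem S.w0_mem) γ (S.pos_subset hγ)).1
  refine (S.pos_or_neg _ h).resolve_left fun h1 => ?_
  have h2 := S.w0_neg _ h1
  have e : S.w0 (S.w0⁻¹ γ) = γ := S.w0.apply_symm_apply γ
  rw [e] at h2
  exact S.pos_not_neg γ hγ h2

lemma coroot_w0 {γ : V} (hγ : γ ∈ S.Rpos) (x : V) :
    S.coroot γ (S.w0 x) = -S.coroot (-(S.w0⁻¹ γ)) x := by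
  obtain ⟨h1, h2⟩ := S.weyl_root (inv_mem S.w0_mem) γ (S.pos_subset hγ)
  have e : S.w0⁻¹ (S.w0 x) = x := S.w0.symm_apply_apply x
  rw [← h2, e, S.coroot_neg _ h1, LinearMap.neg_apply, neg_neg]

lemma coroot_w0_inv {γ : V} (hγ : γ ∈ S.Rpos) (x : V) :
    S.coroot γ (S.w0⁻¹ x) = -S.coroot (-(S.w0 γ)) x := by
  obtain ⟨h1, h2⟩ := S.weyl_root S.w0_mem γ (S.pos_subset hγ)
  have e : S.w0 (S.w0⁻¹ x) = x := S.w0.apply_symm_apply x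
  rw [← h2, e, S.coroot_neg _ h1, LinearMap.neg_apply, neg_neg]

/-- For `x ∈ W̃⁺`, the order `↑` is turned into the Bruhat order by left multiplication
by `w₀`. -/
lemma bruhatLE_w0_mul_of_upLE {x y : V ≃ᵃ[ℝ] V} (hx : x ∈ S.Wplus) {a : V} (ha : a ∈ S.A0)
    (h : S.upLE x y) : S.bruhatLE (S.ofW S.w0 * x) (S.ofW S.w0 * y) := by
  obtain ⟨q, hq, hgen⟩ := exists_generic (S := S) (q₀ := S.w0⁻¹ a) fun γ hγ => by
    have := ha _ (S.w0_neg γ hγ)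
    rw [coroot_w0_inv hγ]
    constructor <;> linarith
  obtain ⟨T, hT⟩ := eventually_LEFrom_of_upLE ha q h
  obtain ⟨t, ht, htF⟩ : ∃ t, max T 0 ≤ t ∧ t ∉ S.crossingTimes q := by
    by_contra! hall
    exact (Set.Icc_infinite (lt_add_one (max T 0))) ((crossingTimes_finite q _).subset
      fun t ht => ⟨hall t ht.1, (le_max_right _ _).trans ht.1, ht.2⟩)
  refine bruhatLE_of_LEFrom ha S.w0_mem (fun γ hγ => ?_)
    (preservesHyperplanes_of_mem_extAff hx.1)
    ((hT t (le_of_max_le_left ht)).ascend hq hgen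
      (fun γ hγ => S.coroot_pos_of_simple (hx.2 a ha) hγ) (le_of_max_le_right ht) htF)
  have := hq _ (w0_inv_neg hγ)
  rw [coroot_w0 hγ]
  constructor <;> linarith

lemma inv_smul_eta_mem_A0 {r : ℝ} (hr : 0 < r) (h : ∀ α ∈ S.R, S.coroot α S.eta < r) :
    r⁻¹ • S.eta ∈ S.A0 := fun α hα => by
  rw [map_smul, smul_eq_mul, inv_mul_eq_div]
  exact ⟨div_pos (S.coroot_eta_pos hα) hr, (div_lt_one hr).2 (h α (S.pos_subset hα))⟩

/-- For `x ∈ W̃⁺` and `α` positive, `s_α w₀ x ≤ w₀ x`. -/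
lemma bruhatLE_reflection_w0_mul {x : V ≃ᵃ[ℝ] V} (hx : x ∈ S.Wplus) {a : V} (ha : a ∈ S.A0)
    {α : V} (hα : α ∈ S.Rpos) {sα : V ≃ₗ[ℝ] V} (hsα : ∀ x, sα x = x - S.coroot α x • α) :
    S.bruhatLE (S.ofW sα * S.ofW S.w0 * x) (S.ofW S.w0 * x) := by
  have hαR := S.pos_subset hα
  have happ : ∀ z, (S.ofW sα * S.ofW S.w0 * x) z = sα (S.w0 (x z)) := fun _ => rfl
  have hself : ∀ v, S.coroot α (sα v) = -S.coroot α v := fun v => by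
    rw [hsα, map_sub, map_smul, smul_eq_mul, S.coroot_self α hαR]
    ring
  have hw : ∀ z, (S.ofW S.w0 * x) z = (S.ofW sα * S.ofW S.w0 * x) z -
      (S.coroot α ((S.ofW sα * S.ofW S.w0 * x) z) - ((0 : ℤ) : ℝ)) • α := fun z => by
    have e : (S.ofW S.w0 * x) z = S.w0 (x z) := rfl
    rw [happ, hself, hsα, e]
    push_cast
    module
  have hpres : S.PreservesHyperplanes (S.ofW sα * S.ofW S.w0 * x) := by
    have hsW : sα ∈ S.Weyl := Subgroup.subset_closure ⟨α, hαR, hsα⟩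
    intro β hβ
    obtain ⟨h1, h2⟩ := S.weyl_root (inv_mem (mul_mem hsW S.w0_mem)) β hβ
    obtain ⟨γ, hγ, m, h3⟩ := preservesHyperplanes_of_mem_extAff hx.1 _ h1
    refine ⟨γ, hγ, m, fun v => ?_⟩
    rw [← h3, happ, ← h2]
    exact congrArg _ ((sα * S.w0).symm_apply_apply _)
  refine .single ⟨⟨S.affReflection hαR 0, ⟨α, hαR, 0, affReflection_apply hαR 0⟩,
    AffineEquiv.ext fun z => ?_⟩, len_lt_of_same_side hpres hαR hw ha ?_⟩
  · rw [hw]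
    exact (affReflection_apply hαR 0 _).symm
  · rw [happ, hself, coroot_w0 hα, neg_neg]
    have h1 := S.coroot_pos_of_simple (hx.2 a ha) (w0_inv_neg hα)
    have h2 := (ha α hα).1
    simpa using mul_pos h2 h1

end Ctx


/-- `s_α w₀ w̃₁ ≤ w₀ w̃_h⁻¹ w̃₂` in the Bruhat order on `W̃`. -/
theorem statement6 {V : Type} [AddCommGroup V] [Module ℝ V] [FiniteDimensional ℝ V]
    (S : Ctx V) (p : ℕ) (hp : p.Prime) (hηp : ∀ α ∈ S.R, S.coroot α S.eta < (p : ℝ))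
    (α : V) (hα : α ∈ S.Δ)
    (sα : V ≃ₗ[ℝ] V) (hsα : ∀ x, sα x = x - S.coroot α x • α)
    (w₂ : V ≃ᵃ[ℝ] V) (hw₂ : w₂ ∈ S.Wone)
    (w₁ : V ≃ᵃ[ℝ] V) (hw₁ : w₁ ∈ S.Wplus)
    (hup : S.upLE w₁ (S.wh⁻¹ * w₂)) :
    S.bruhatLE (S.ofW sα * S.ofW S.w0 * w₁) (S.ofW S.w0 * S.wh⁻¹ * w₂) := by
  have ha := Ctx.inv_smul_eta_mem_A0 (Nat.cast_pos.2 hp.pos) hηp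
  rw [mul_assoc (S.ofW S.w0)]
  exact (Ctx.bruhatLE_reflection_w0_mul hw₁ ha (S.simple_subset hα) hsα).trans
    (Ctx.bruhatLE_w0_mul_of_upLE hw₁ ha hup)

end SerrePaper
end

section
/- Let X be a finite free ℤ-module, Q ⊆ X a subgroup such that the torsion subgroup of X/Q is a p-group, and π an automorphism of X of finite order with π(Q) = Q. If ν ∈ X satisfies pν − π(ν) ∈ Q, then ν ∈ Q. -/
theorem AddEquiv.mem_iff_iterate_mem {X : Type*} [AddCommGroup X] {Q : AddSubgroup X} {π : X ≃+ X}
    (hπQ : ∀ x : X, x ∈ Q ↔ π x ∈ Q) (j : ℕ) (x : X) : x ∈ Q ↔ (⇑π)^[j] x ∈ Q := by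
  induction j generalizing x with
  | zero => rfl
  | succ j ih => rw [Function.iterate_succ_apply, ← ih, hπQ]

theorem AddSubgroup.pow_nsmul_sub_iterate_mem {X : Type*} [AddCommGroup X] {Q : AddSubgroup X}
    {π : X ≃+ X} (hπQ : ∀ x : X, x ∈ Q ↔ π x ∈ Q) {p : ℕ} {ν : X} (hν : p • ν - π ν ∈ Q)
    (j : ℕ) : p ^ j • ν - (⇑π)^[j] ν ∈ Q := by
  induction j with
  | zero => simp
  | succ j ih =>
    have h := Q.add_mem (Q.nsmul_mem hν (p ^ j)) ((hπQ _).1 ih)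
    rwa [map_sub, map_nsmul, nsmul_sub, sub_add_sub_cancel, smul_smul, ← pow_succ,
      ← Function.iterate_succ_apply' π] at h


/-- Claim `rootlattice`: let `X` be a finite free `ℤ`-module, `Q ⊆ X` a
subgroup such that the torsion subgroup of `X/Q` is a `p`-group, and `π` an automorphism
of `X` of finite order with `π(Q) = Q`.  If `ν ∈ X` satisfies `pν − π(ν) ∈ Q`, then
`ν ∈ Q`. -/
theorem statement9 (p : ℕ) (hp : p.Prime)
    (X : Type) [AddCommGroup X] [Module.Free ℤ X] [Module.Finite ℤ X]
    (Q : AddSubgroup X)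
    (htors : ∀ x : X ⧸ Q, (∃ n : ℕ, 0 < n ∧ n • x = 0) → ∃ k : ℕ, p ^ k • x = 0)
    (π : X ≃+ X) (hord : ∃ m : ℕ, 0 < m ∧ ∀ x : X, (⇑π)^[m] x = x)
    (hπQ : ∀ x : X, x ∈ Q ↔ π x ∈ Q)
    (ν : X) (hν : p • ν - π ν ∈ Q) : ν ∈ Q := by
  obtain ⟨m, hm, hπm⟩ := hord
  have hpm : 1 < p ^ m := Nat.one_lt_pow hm.ne' hp.one_lt
  have hmem : (p ^ m - 1) • ν ∈ Q := by
    have h := AddSubgroup.pow_nsmul_sub_iterate_mem hπQ hν m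
    rwa [hπm, ← Nat.sub_add_cancel hpm.le, succ_nsmul, add_sub_cancel_right] at h
  obtain ⟨k, hk⟩ := htors (ν : X ⧸ Q) ⟨p ^ m - 1, by omega, by
    rwa [← QuotientAddGroup.mk_nsmul, QuotientAddGroup.eq_zero_iff]⟩
  rw [← QuotientAddGroup.mk_nsmul, QuotientAddGroup.eq_zero_iff] at hk
  rw [AddEquiv.mem_iff_iterate_mem hπQ k]
  have h := Q.sub_mem hk (AddSubgroup.pow_nsmul_sub_iterate_mem hπQ hν k)
  rwa [sub_sub_cancel] at h
end

section
/- Suppose μ−η and λ−η lie in the lowest p-alcove C₀, μ−λ ∈ ℤR, s, w ∈ W, and there exist u ∈ W and ν ∈ X such that w = u s π(u)⁻¹ and λ = u(μ) + pν − w(π(ν)). Then ν is dominant, i.e. ⟨ν,α∨⟩ ≥ 0 for all α ∈ Δ. -/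
open scoped Classical Pointwise

namespace SerrePaper

variable (V : Type) [AddCommGroup V] [Module ℝ V]

namespace Ctx

variable {V : Type} [AddCommGroup V] [Module ℝ V] (S : Ctx V)

/-- A linear automorphism stabilizes the root system together with its coroot pairing. -/
def PreservesRoots (g : V ≃ₗ[ℝ] V) : Prop :=
  ∀ α ∈ S.R, g α ∈ S.R ∧ ∀ x, S.coroot (g α) (g x) = S.coroot α x

variable {S}

theorem PreservesRoots.exists_preimage {g : V ≃ₗ[ℝ] V} (hg : S.PreservesRoots g)
    {β : V} (hβ : β ∈ S.R) : ∃ α ∈ S.R, g α = β := by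
  obtain ⟨α, hα, h⟩ := Finset.surj_on_of_inj_on_of_card_le (s := S.R) (t := S.R)
    (fun a _ => g a) (fun a ha => (hg a ha).1) (fun _ _ _ _ h => g.injective h) le_rfl β hβ
  exact ⟨α, hα, h.symm⟩

theorem PreservesRoots.mul {g h : V ≃ₗ[ℝ] V} (hg : S.PreservesRoots g)
    (hh : S.PreservesRoots h) : S.PreservesRoots (g * h) := fun α hα =>
  ⟨(hg _ (hh α hα).1).1, fun x => ((hg _ (hh α hα).1).2 (h x)).trans ((hh α hα).2 x)⟩

theorem PreservesRoots.inv {g : V ≃ₗ[ℝ] V} (hg : S.PreservesRoots g) :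
    S.PreservesRoots g⁻¹ := by
  intro β hβ
  obtain ⟨α, hα, rfl⟩ := hg.exists_preimage hβ
  have hinv : ∀ y, g⁻¹ (g y) = y := g.symm_apply_apply
  have hinv' : ∀ y, g (g⁻¹ y) = y := g.apply_symm_apply
  refine ⟨by rwa [hinv], fun x => ?_⟩
  rw [hinv, ← (hg α hα).2, hinv']

theorem preservesRoots_of_mem_weyl {g : V ≃ₗ[ℝ] V} (hg : g ∈ S.Weyl) :
    S.PreservesRoots g := by
  induction hg using Subgroup.closure_induction with
  | mem g hg =>
    obtain ⟨α, hα, h⟩ := hg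
    intro β hβ
    refine ⟨by rw [h]; exact S.reflect_root α hα β hβ, fun x => ?_⟩
    rw [h β, S.reflect_coroot α hα β hβ, h x]
    simp only [map_sub, map_smul, smul_eq_mul, S.coroot_self α hα]
    ring
  | one => exact fun α hα => ⟨hα, fun _ => rfl⟩
  | mul _ _ _ _ hg hh => exact hg.mul hh
  | inv _ _ hg => exact hg.inv

theorem coroot_le_of_sub_eta_mem_C0 {p : ℕ} {x : V} (hx : x ∈ S.X)
    (hxC : x - S.eta ∈ S.C0 p) {α : V} (hα : α ∈ S.R) : S.coroot α x ≤ (p : ℝ) - 1 := by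
  obtain ⟨n, hn⟩ := S.coroot_int α hα x hx
  have hlt : S.coroot α x < p := by
    rcases S.pos_or_neg α hα with h | h
    · simpa using (hxC α h).2
    · have h₁ := (hxC _ h).1
      rw [sub_add_cancel, S.coroot_neg α hα, LinearMap.neg_apply] at h₁
      have : (0 : ℝ) ≤ p := p.cast_nonneg
      linarith
  rw [hn] at hlt ⊢
  have : n < (p : ℤ) := by exact_mod_cast hlt
  exact_mod_cast Int.le_sub_one_of_lt this

theorem one_le_coroot_of_sub_eta_mem_C0 {p : ℕ} {x : V} (hx : x ∈ S.X)
    (hxC : x - S.eta ∈ S.C0 p) {α : V} (hα : α ∈ S.Rpos) : 1 ≤ S.coroot α x := by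
  obtain ⟨n, hn⟩ := S.coroot_int α (S.pos_subset hα) x hx
  have hpos := (hxC α hα).1
  rw [sub_add_cancel, hn] at hpos
  rw [hn]
  have : 0 < n := by exact_mod_cast hpos
  exact_mod_cast this

/-- An automorphism `g` preserving the roots permutes the roots pairing with `ν` to the value `c`
as soon as each of them pairs with `g ν` to `c` as well. -/
theorem PreservesRoots.coroot_eq_of_coroot_map_eq {g : V ≃ₗ[ℝ] V} (hg : S.PreservesRoots g)
    {ν : V} {c : ℝ} (hc : ∀ β ∈ S.R, S.coroot β ν = c → S.coroot β (g ν) = c)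
    {β : V} (hβ : β ∈ S.R) (h : S.coroot β (g ν) = c) : S.coroot β ν = c := by
  set B := S.R.filter fun β => S.coroot β ν = c
  have hmap : ∀ γ ∈ B, g⁻¹ γ ∈ B := by
    intro γ hγ
    obtain ⟨hγR, hγc⟩ := Finset.mem_filter.1 hγ
    obtain ⟨hmem, hpair⟩ := hg.inv γ hγR
    refine Finset.mem_filter.2 ⟨hmem, ?_⟩
    have := hpair (g ν)
    rw [show g⁻¹ (g ν) = ν from g.symm_apply_apply ν] at this
    rw [this, hc γ hγR hγc]
  obtain ⟨hmem, hpair⟩ := hg.inv β hβ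
  have hpre : g⁻¹ β ∈ B := by
    refine Finset.mem_filter.2 ⟨hmem, ?_⟩
    have := hpair (g ν)
    rwa [show g⁻¹ (g ν) = ν from g.symm_apply_apply ν, h] at this
  obtain ⟨γ, hγ, hγβ⟩ := Finset.surj_on_of_inj_on_of_card_le (s := B) (t := B)
    (fun a _ => g⁻¹ a) hmap (fun _ _ _ _ h => g⁻¹.injective h) le_rfl _ hpre
  rw [g⁻¹.injective hγβ]
  exact (Finset.mem_filter.1 hγ).2

end Ctx

/-- Claim `dom`: the weight `ν` is dominant. -/
theorem statement12 {V : Type} [AddCommGroup V] [Module ℝ V] [FiniteDimensional ℝ V]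
    (S : Ctx V) (p : ℕ) (hp : p.Prime) (hηp : ∀ α ∈ S.R, S.coroot α S.eta < (p : ℝ))
    (π : V ≃ₗ[ℝ] V)
    (hπR : ∀ α ∈ S.R, π α ∈ S.R) (hπpos : ∀ α ∈ S.Rpos, π α ∈ S.Rpos)
    (hπΔ : ∀ α ∈ S.Δ, π α ∈ S.Δ) (hπX : ∀ x ∈ S.X, π x ∈ S.X)
    (hπpair : ∀ α ∈ S.R, ∀ x : V, S.coroot (π α) (π x) = S.coroot α x)
    (hπη : π S.eta = S.eta)
    (hπord : ∃ m : ℕ, 0 < m ∧ π ^ m = 1)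
    (μ lam : V) (hμX : μ ∈ S.X) (hlamX : lam ∈ S.X)
    (hμC : μ - S.eta ∈ S.C0 p) (hlamC : lam - S.eta ∈ S.C0 p)
    (hdiff : μ - lam ∈ S.rootLattice)
    (s w u : V ≃ₗ[ℝ] V) (hs : s ∈ S.Weyl) (hw : w ∈ S.Weyl) (hu : u ∈ S.Weyl)
    (ν : V) (hν : ν ∈ S.X)
    (hconj : w = u * s * π * u⁻¹ * π⁻¹)
    (hlam : lam = u μ + (p : ℝ) • ν - w (π ν)) :
    ∀ α ∈ S.Δ, 0 ≤ S.coroot α ν := by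
  have hwR := Ctx.preservesRoots_of_mem_weyl hw
  have huR := Ctx.preservesRoots_of_mem_weyl hu
  have hg : S.PreservesRoots (w * π) := hwR.mul fun α hα => ⟨hπR α hα, hπpair α hα⟩
  have hlam' : ∀ β, (p : ℝ) * S.coroot β ν =
      S.coroot β lam - S.coroot β (u μ) + S.coroot β ((w * π) ν) := by
    intro β
    have h := congrArg (S.coroot β) hlam
    simp only [map_sub, map_add, map_smul, smul_eq_mul] at h
    change _ = _ + S.coroot β (w (π ν))
    linarith
  have hp2 : (2 : ℝ) ≤ p := by exact_mod_cast hp.two_le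
  have hlamle : ∀ β ∈ S.R, S.coroot β lam ≤ p - 1 := fun β hβ =>
    Ctx.coroot_le_of_sub_eta_mem_C0 hlamX hlamC hβ
  have hule : ∀ β ∈ S.R, S.coroot β (u μ) ≤ p - 1 := by
    intro β hβ
    obtain ⟨γ, hγ, rfl⟩ := huR.exists_preimage hβ
    rw [(huR γ hγ).2]
    exact Ctx.coroot_le_of_sub_eta_mem_C0 hμX hμC hγ
  have hneg : ∀ β ∈ S.R, ∀ x, S.coroot (-β) x = -S.coroot β x := fun β hβ x => by
    rw [S.coroot_neg β hβ, LinearMap.neg_apply]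
  have huge : ∀ β ∈ S.R, -(p - 1 : ℝ) ≤ S.coroot β (u μ) := by
    intro β hβ
    have := hule _ (S.neg_mem β hβ)
    rw [hneg β hβ] at this
    linarith
  have hgle : ∀ M : ℝ, (∀ β ∈ S.R, S.coroot β ν ≤ M) →
      ∀ β ∈ S.R, S.coroot β ((w * π) ν) ≤ M := by
    intro M hM β hβ
    obtain ⟨γ, hγ, rfl⟩ := hg.exists_preimage hβ
    rw [(hg γ hγ).2]
    exact hM γ hγ
  have hν2 : ∀ β ∈ S.R, S.coroot β ν ≤ 2 := by
    intro β hβ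
    obtain ⟨β₀, hβ₀, hmax⟩ := S.R.exists_max_image (fun β => S.coroot β ν) ⟨β, hβ⟩
    have h₁ := hgle _ hmax β₀ hβ₀
    have h₂ := hlam' β₀
    have h₃ := hlamle β₀ hβ₀
    have h₄ := huge β₀ hβ₀
    have h₅ := hmax β hβ
    nlinarith
  have hg2 := hgle 2 hν2
  intro α hα
  have hαR := S.pos_subset (S.simple_subset hα)
  by_contra! hlt
  obtain ⟨n, hn⟩ := S.coroot_int α hαR ν hν
  have hn1 : S.coroot α ν ≤ -1 := by
    rw [hn] at hlt ⊢
    have : n < 0 := by exact_mod_cast hlt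
    exact_mod_cast Int.le_sub_one_of_lt this
  have h₁ := hlam' α
  have h₂ := Ctx.one_le_coroot_of_sub_eta_mem_C0 hlamX hlamC (S.simple_subset hα)
  have h₃ := hule α hαR
  have h₄ : -2 ≤ S.coroot α ((w * π) ν) := by
    have := hg2 _ (S.neg_mem α hαR)
    rw [hneg α hαR] at this
    linarith
  have hgα : S.coroot (-α) ((w * π) ν) = 2 := by
    rw [hneg α hαR]
    nlinarith
  have hνα : S.coroot (-α) ν = 2 := by
    refine hg.coroot_eq_of_coroot_map_eq (fun β hβ hβν => ?_) (S.neg_mem α hαR) hgα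
    have h₅ := hlam' β
    have h₆ := hlamle β hβ
    have h₇ := huge β hβ
    have h₈ := hg2 β hβ
    rw [hβν] at h₅
    linarith
  rw [hneg α hαR] at hνα
  nlinarith

end SerrePaper
end
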